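/- Let F be a field (or commutative ring) and let a, b, q, r ∈ F[x] with b monic of degree d₁, deg a ≤ d₀ + d₁, deg q ≤ d₀, deg r < d₁, and a = q·b + r, where d₀, d₁ ≥ 0 are integers. Define rev_h(f) = x^{h − deg f}·reverse(f) (equivalently, rev_h(f) = x^h·f(1/x), the coefficient sequence of f reversed in a window of length h+1). Then x^{d₀+1} divides rev_{d₀+d₁}(a) − rev_{d₀}(q)·rev_{d₁}(b) in F[x]. -/

import Mathlib

open Polynomial

theorem X_pow_dvd_reflect_of_degree_lt {R : Type*} [Semiring R] {m n : ℕ} {f : R[X]}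
    (hf : f.degree < (n : WithBot ℕ)) : (X : R[X]) ^ (m + 1) ∣ reflect (m + n) f := by
  rw [X_pow_dvd_iff]
  intro i hi
  rw [coeff_reflect, revAt_le (by lia)]
  exact coeff_eq_zero_of_degree_lt (hf.trans_le (by exact_mod_cast (by lia : n ≤ m + n - i)))

theorem stmt_9 {F : Type*} [CommRing F] (d₀ d₁ : ℕ) (a b q r : F[X])
    (hb : b.Monic) (hbd : b.natDegree = d₁)
    (ha : a.natDegree ≤ d₀ + d₁) (hq : q.natDegree ≤ d₀)
    (hr : r.degree < (d₁ : WithBot ℕ)) (heq : a = q * b + r) :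
    (X : F[X])^(d₀ + 1) ∣ (reflect (d₀ + d₁) a - reflect d₀ q * reflect d₁ b) := by
  rw [heq, reflect_add, reflect_mul q b hq hbd.le, add_sub_cancel_left]
  exact X_pow_dvd_reflect_of_degree_lt hr
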